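/- arXiv:1308.4743 — 2 statements merged into one kernel-verified Lean document; each statement's English description precedes it below -/
import Mathlib

section
/- Let O_v be a valuation domain with fraction field F and let R be a torsion-free O_v-algebra with [R ⊗_{O_v} F : F] finite. Then R satisfies incomparability (INC) over O_v: if Q₁ ⊊ Q₂ are prime ideals of R, then Q₁ ∩ O_v ⊊ Q₂ ∩ O_v. -/
open scoped TensorProduct

/-- A (left) ideal of a possibly noncommutative ring is two-sided. -/
def IsTwoSidedI {R : Type*} [Ring R] (Q : Ideal R) : Prop :=
  ∀ a ∈ Q, ∀ r : R, a * r ∈ Q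

/-- Primeness for two-sided ideals of a possibly noncommutative ring. -/
def IsPrimeNC {R : Type*} [Ring R] (Q : Ideal R) : Prop :=
  Q ≠ ⊤ ∧ ∀ x y : R, (∀ r : R, x * r * y ∈ Q) → x ∈ Q ∨ y ∈ Q

open scoped nonZeroDivisors

/-- In a valuation domain, some member of a nonempty finite family divides all the others. -/
theorem ValuationRing.exists_forall_dvd {O ι : Type*} [CommRing O] [IsDomain O] [ValuationRing O]
    {s : Finset ι} (hs : s.Nonempty) (c : ι → O) : ∃ j ∈ s, ∀ i ∈ s, c j ∣ c i := by
  induction hs using Finset.Nonempty.cons_induction with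
  | singleton a => exact ⟨a, by simp, by simp⟩
  | cons a s ha hs ih =>
    obtain ⟨j, hj, hdvd⟩ := ih
    rcases ValuationRing.dvd_total (c j) (c a) with h | h
    · refine ⟨j, by simp [hj], fun i hi => ?_⟩
      rcases Finset.mem_cons.1 hi with rfl | hi
      exacts [h, hdvd i hi]
    · refine ⟨a, by simp, fun i hi => ?_⟩
      rcases Finset.mem_cons.1 hi with rfl | hi
      exacts [dvd_rfl, h.trans (hdvd i hi)]

/-- Over a valuation domain, a family in a torsion-free module is linearly independent as soon as
its image is linearly independent over some nontrivial algebra. -/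
theorem LinearIndependent.of_map_of_valuationRing {O D M N ι : Type*} [CommRing O] [IsDomain O]
    [ValuationRing O] [CommRing D] [Nontrivial D] [Algebra O D] [AddCommGroup M] [Module O M]
    [AddCommGroup N] [Module O N] [Module D N] [IsScalarTower O D N]
    (hM : ∀ (c : O) (m : M), c • m = 0 → c = 0 ∨ m = 0)
    (φ : M →ₗ[O] N) {v : ι → M} (hv : LinearIndependent D (φ ∘ v)) : LinearIndependent O v := by
  rw [linearIndependent_iff'] at hv ⊢
  intro s c hc i hi
  obtain ⟨j, hj, hdvd⟩ := ValuationRing.exists_forall_dvd ⟨i, hi⟩ c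
  by_cases hj0 : c j = 0
  · exact zero_dvd_iff.1 (hj0 ▸ hdvd i hi)
  have hd : ∀ i, ∃ d, i ∈ s → c i = c j * d := fun i => by
    by_cases his : i ∈ s
    · exact (hdvd i his).imp fun d h _ => h
    · exact ⟨0, fun h => absurd h his⟩
  choose d hd using hd
  have hsum : ∑ i ∈ s, d i • v i = 0 := by
    refine (hM (c j) _ ?_).resolve_left hj0
    rw [← hc, Finset.smul_sum]
    exact Finset.sum_congr rfl fun i hi => by rw [hd i hi, mul_smul]
  have hmap : ∑ i ∈ s, algebraMap O D (d i) • (φ ∘ v) i = 0 := by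
    simpa using congrArg φ hsum
  have hdj : d j = 1 := mul_left_cancel₀ hj0 (by rw [← hd j hj, mul_one])
  have := hv s _ hmap j hj
  simp [hdj] at this

/-- The rank of a quotient of a torsion-free module over a valuation domain, taken over a
nontrivial algebra, does not exceed the rank of the module. -/
theorem rank_le_of_surjective_of_valuationRing.{u, v, w} {O : Type v} {D : Type w} {M N : Type u}
    [CommRing O] [IsDomain O] [ValuationRing O] [CommRing D] [Nontrivial D] [Algebra O D]
    [AddCommGroup M] [Module O M] [AddCommGroup N] [Module O N] [Module D N] [IsScalarTower O D N]
    (hM : ∀ (c : O) (m : M), c • m = 0 → c = 0 ∨ m = 0)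
    (φ : M →ₗ[O] N) (hφ : Function.Surjective φ) : Module.rank D N ≤ Module.rank O M := by
  rw [Module.rank]
  refine ciSup_le' fun ⟨s, hs⟩ => ?_
  refine LinearIndependent.cardinal_le_rank
    (LinearIndependent.of_map_of_valuationRing (D := D) hM φ
      (v := fun x : s => Function.surjInv hφ x) ?_)
  have : (φ ∘ fun x : s => Function.surjInv hφ (x : N)) = (fun x => x : s → N) :=
    funext fun x => Function.surjInv_eq hφ x
  rw [this]
  exact hs

/-- A nonzero two-sided ideal of a prime Artinian ring is the whole ring. -/
theorem Ideal.eq_top_of_isPrimeNC_bot {A : Type*} [Ring A] [IsArtinianRing A]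
    (hA : IsPrimeNC (⊥ : Ideal A)) {I : Ideal A} (hI : IsTwoSidedI I) (hI0 : I ≠ ⊥) : I = ⊤ := by
  have hprime : ∀ {J L : Ideal A}, IsTwoSidedI J → J * L = ⊥ → J = ⊥ ∨ L = ⊥ := by
    intro J L hJ hJL
    by_contra! h
    obtain ⟨x, hx, hx0⟩ := J.ne_bot_iff.1 h.1
    obtain ⟨y, hy, hy0⟩ := L.ne_bot_iff.1 h.2
    rcases hA.2 x y fun r => hJL ▸ Ideal.mul_mem_mul (hJ x hx r) hy with h | h
    exacts [hx0 h, hy0 h]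
  have hjac : Ring.jacobson A = ⊥ := by
    obtain ⟨n, hn⟩ := IsArtinianRing.isNilpotent_jacobson_bot (R := A)
    rw [Ideal.jacobson_bot] at hn
    have htwo : IsTwoSidedI (Ring.jacobson A) := fun a ha r =>
      Ideal.mul_mem_right r _ ha
    induction n with
    | zero => exact absurd (by rwa [Submodule.pow_zero, Ideal.one_eq_top, eq_comm] at hn) hA.1
    | succ n ih =>
      rw [Ideal.zero_eq_bot] at *
      by_cases h0 : n = 0
      · rwa [h0, Submodule.pow_one] at hn
      rw [Submodule.pow_succ' _ h0] at hn
      exact (hprime htwo hn).elim id ih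
  have := IsArtinianRing.isSemisimpleRing_iff_jacobson.2 hjac
  obtain ⟨L, hL⟩ := exists_isCompl I
  have hIL : I * L = ⊥ := by
    refine eq_bot_iff.2 (le_trans ?_ hL.inf_eq_bot.le)
    exact Ideal.mul_le.2 fun a ha b hb => ⟨hI a ha b, L.mul_mem_left a hb⟩
  have hL0 := (hprime hI hIL).resolve_left hI0
  simpa [hL0] using hL.sup_eq_top

/-- In a prime torsion-free algebra of finite rank over a domain, every nonzero two-sided ideal
meets the domain nontrivially. -/
theorem exists_algebraMap_mem_of_isPrimeNC_bot {D B : Type*} [CommRing D] [IsDomain D] [Ring B]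
    [Algebra D B] (hB : ∀ (d : D) (b : B), d • b = 0 → d = 0 ∨ b = 0)
    (hfin : Module.rank D B < Cardinal.aleph0) (hprime : IsPrimeNC (⊥ : Ideal B))
    {I : Ideal B} (hI : IsTwoSidedI I) (hI0 : I ≠ ⊥) : ∃ d : D, d ≠ 0 ∧ algebraMap D B d ∈ I := by
  let K := FractionRing D
  let A := K ⊗[D] B
  let f : B →ₐ[D] A := Algebra.TensorProduct.includeRight
  have hloc : IsLocalizedModule D⁰ (TensorProduct.mk D K B 1) := inferInstance
  have hsurj : ∀ a : A, ∃ d : D, d ≠ 0 ∧ ∃ b, d • a = f b := fun a => by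
    obtain ⟨⟨b, d⟩, h⟩ := IsLocalizedModule.surj D⁰ (TensorProduct.mk D K B 1) a
    exact ⟨d, nonZeroDivisors.ne_zero d.2, b, h⟩
  have hinj : Function.Injective f := by
    refine (injective_iff_map_eq_zero f).2 fun b hb => ?_
    obtain ⟨d, hd⟩ := (IsLocalizedModule.eq_zero_iff D⁰ (TensorProduct.mk D K B 1)).1 hb
    exact (hB d b hd).resolve_left (nonZeroDivisors.ne_zero d.2)
  have hAtf : ∀ (d : D) (a : A), d ≠ 0 → d • a = 0 → a = 0 := fun d a hd h => by
    rw [← algebraMap_smul K d a] at h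
    exact (smul_eq_zero.1 h).resolve_left
      ((map_ne_zero_iff _ (IsFractionRing.injective D K)).2 hd)
  have hAfin : Module.Finite K A := by
    rw [← Module.rank_lt_aleph0_iff, IsFractionRing.rank_right_eq D K A,
      ← Cardinal.lift_lt_aleph0, IsLocalizedModule.lift_rank_eq D⁰ (TensorProduct.mk D K B 1) le_rfl,
      Cardinal.lift_lt_aleph0]
    exact hfin
  have : IsArtinianRing A := IsArtinianRing.of_finite K A
  have hA : IsPrimeNC (⊥ : Ideal A) := by
    refine ⟨fun h => hprime.1 ?_, fun x y hxy => ?_⟩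
    · rw [Ideal.eq_top_iff_one, Ideal.mem_bot] at h ⊢
      exact hinj (by rw [map_one, map_zero, h])
    · obtain ⟨d, hd, b, hb⟩ := hsurj x
      obtain ⟨e, he, c, hc⟩ := hsurj y
      have hbc : ∀ r, b * r * c ∈ (⊥ : Ideal B) := fun r => by
        refine (Ideal.mem_bot).2 (hinj ?_)
        have h0 : x * f r * y = 0 := hxy (f r)
        rw [map_mul, map_mul, ← hb, ← hc, map_zero, smul_mul_assoc, smul_mul_assoc,
          mul_smul_comm, h0, smul_zero, smul_zero]
      refine (hprime.2 b c hbc).imp (fun h => ?_) fun h => ?_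
      · rw [Ideal.mem_bot] at h
        exact hAtf d x hd (by rw [hb, h, map_zero])
      · rw [Ideal.mem_bot] at h
        exact hAtf e y he (by rw [hc, h, map_zero])
  let J : Ideal A :=
    { carrier := {a | ∃ d : D, d ≠ 0 ∧ ∃ b ∈ I, d • a = f b}
      zero_mem' := ⟨1, one_ne_zero, 0, I.zero_mem, by simp⟩
      add_mem' := by
        rintro x y ⟨d, hd, b, hb, hx⟩ ⟨e, he, c, hc, hy⟩
        refine ⟨d * e, mul_ne_zero hd he, e • b + d • c,
          I.add_mem (I.smul_of_tower_mem e hb) (I.smul_of_tower_mem d hc), ?_⟩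
        rw [map_add, map_smul, map_smul, ← hx, ← hy, smul_add, mul_smul, mul_smul, smul_comm d e x]
      smul_mem' := by
        rintro r x ⟨d, hd, b, hb, hx⟩
        obtain ⟨e, he, c, hr⟩ := hsurj r
        refine ⟨e * d, mul_ne_zero he hd, c * b, I.mul_mem_left c hb, ?_⟩
        rw [map_mul, ← hx, ← hr, smul_eq_mul, smul_mul_smul_comm] }
  have hJ : IsTwoSidedI J := by
    rintro x ⟨d, hd, b, hb, hx⟩ r
    obtain ⟨e, he, c, hr⟩ := hsurj r
    refine ⟨d * e, mul_ne_zero hd he, b * c, hI b hb c, ?_⟩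
    rw [map_mul, ← hx, ← hr, smul_mul_smul_comm]
  have hJ0 : J ≠ ⊥ := by
    obtain ⟨b, hb, hb0⟩ := I.ne_bot_iff.1 hI0
    refine J.ne_bot_iff.2 ⟨f b, ⟨1, one_ne_zero, b, hb, one_smul _ _⟩, ?_⟩
    exact (map_ne_zero_iff f hinj).2 hb0
  have hJtop := Ideal.eq_top_of_isPrimeNC_bot hA hJ hJ0
  obtain ⟨d, hd, b, hb, h⟩ := (Ideal.eq_top_iff_one J).1 hJtop
  refine ⟨d, hd, ?_⟩
  have : f (algebraMap D B d) = f b := by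
    rw [← h, AlgHom.commutes, Algebra.algebraMap_eq_smul_one]
  rwa [hinj this]

/-- **INC.** Let `O` be a valuation domain with fraction field `F` and
`R` a torsion-free `O`-algebra with `R ⊗[O] F` finite dimensional over `F`.
If `Q₁ ⊊ Q₂` are prime ideals of `R`, then `Q₁ ∩ O ⊊ Q₂ ∩ O`. -/
theorem stmt6 {O F R : Type*} [CommRing O] [IsDomain O] [ValuationRing O]
    [Field F] [Algebra O F] [IsFractionRing O F]
    [Ring R] [Algebra O R] [NoZeroSMulDivisors O R]
    [Module.Finite F (F ⊗[O] R)]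
    (Q₁ Q₂ : Ideal R) (h₁ : IsTwoSidedI Q₁) (h₁' : IsPrimeNC Q₁)
    (h₂ : IsTwoSidedI Q₂) (h₂' : IsPrimeNC Q₂) (hlt : Q₁ < Q₂) :
    Q₁.comap (algebraMap O R) < Q₂.comap (algebraMap O R) := by
  have : Q₁.IsTwoSided := ⟨fun b ha => h₁ _ ha b⟩
  let P := Q₁.comap (algebraMap O R)
  have hsmul : ∀ (c : O) (r : R), c • r ∈ Q₁ → c ∈ P ∨ r ∈ Q₁ := fun c r h =>
    h₁'.2 (algebraMap O R c) r fun x => by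
      rw [mul_assoc, ← Algebra.smul_def, ← mul_smul_comm]
      exact Q₁.mul_mem_left x h
  have hP : P.IsPrime := by
    refine ⟨(Ideal.ne_top_iff_one _).2 fun h => h₁'.1 ?_, fun {x y} hxy => hsmul x _ ?_⟩
    · exact (Ideal.eq_top_iff_one _).2 (by simpa [P] using h)
    · rw [Algebra.smul_def, ← map_mul]
      exact hxy
  have htower : IsScalarTower O (O ⧸ P) (R ⧸ Q₁) := by
    refine IsScalarTower.of_algebraMap_eq fun x => rfl
  have hrank : Module.rank (O ⧸ P) (R ⧸ Q₁) < Cardinal.aleph0 := by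
    refine (rank_le_of_surjective_of_valuationRing (D := O ⧸ P)
      (fun c m h => eq_zero_or_eq_zero_of_smul_eq_zero h)
      (Ideal.Quotient.mkₐ O Q₁).toLinearMap
      (Ideal.Quotient.mkₐ_surjective O Q₁)).trans_lt ?_
    rw [← Cardinal.lift_lt_aleph0,
      ← IsLocalizedModule.lift_rank_eq O⁰ (TensorProduct.mk O F R 1) le_rfl,
      Cardinal.lift_lt_aleph0, ← IsFractionRing.rank_right_eq O F (F ⊗[O] R)]
    exact Module.rank_lt_aleph0_iff.2 inferInstance
  have htf : ∀ (d : O ⧸ P) (b : R ⧸ Q₁), d • b = 0 → d = 0 ∨ b = 0 := by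
    intro d b h
    obtain ⟨c, rfl⟩ := Ideal.Quotient.mk_surjective d
    obtain ⟨r, rfl⟩ := Ideal.Quotient.mk_surjective b
    rw [Ideal.Quotient.eq_zero_iff_mem, Ideal.Quotient.eq_zero_iff_mem]
    exact hsmul c r (Ideal.Quotient.eq_zero_iff_mem.1 h)
  have hprime : IsPrimeNC (⊥ : Ideal (R ⧸ Q₁)) := by
    refine ⟨fun h => h₁'.1 ?_, fun x y hxy => ?_⟩
    · rw [Ideal.eq_top_iff_one, Ideal.mem_bot, ← map_one (Ideal.Quotient.mk Q₁),
        Ideal.Quotient.eq_zero_iff_mem] at h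
      exact (Ideal.eq_top_iff_one _).2 h
    · obtain ⟨x, rfl⟩ := Ideal.Quotient.mk_surjective x
      obtain ⟨y, rfl⟩ := Ideal.Quotient.mk_surjective y
      simp only [Ideal.mem_bot, Ideal.Quotient.eq_zero_iff_mem] at hxy ⊢
      refine h₁'.2 x y fun r => Ideal.Quotient.eq_zero_iff_mem.1 ?_
      simpa using hxy (Ideal.Quotient.mk Q₁ r)
  let I : Ideal (R ⧸ Q₁) := Q₂.map (Ideal.Quotient.mk Q₁)
  have hmem : ∀ x : R, Ideal.Quotient.mk Q₁ x ∈ I ↔ x ∈ Q₂ := fun x =>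
    Ideal.mem_quotient_iff_mem hlt.le
  have hI : IsTwoSidedI I := by
    intro a ha r
    obtain ⟨a, rfl⟩ := Ideal.Quotient.mk_surjective a
    obtain ⟨r, rfl⟩ := Ideal.Quotient.mk_surjective r
    rw [← map_mul, hmem]
    exact h₂ a ((hmem a).1 ha) r
  obtain ⟨q, hq₂, hq₁⟩ := Set.exists_of_ssubset hlt
  have hI0 : I ≠ ⊥ := I.ne_bot_iff.2
    ⟨Ideal.Quotient.mk Q₁ q, (hmem q).2 hq₂, fun h => hq₁ (Ideal.Quotient.eq_zero_iff_mem.1 h)⟩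
  obtain ⟨d, hd, hdI⟩ := exists_algebraMap_mem_of_isPrimeNC_bot htf hrank hprime hI hI0
  obtain ⟨c, rfl⟩ := Ideal.Quotient.mk_surjective d
  refine SetLike.lt_iff_le_and_exists.2 ⟨Ideal.comap_mono hlt.le, c, (hmem _).1 hdI, fun hc => ?_⟩
  exact hd (Ideal.Quotient.eq_zero_iff_mem.2 hc)
end

section
/- Let O_v be a valuation domain with fraction field F and let R be a torsion-free O_v-algebra with [R ⊗_{O_v} F : F] finite and (R^× ∩ O_v) ⊆ O_v^×. Then the Krull dimension of R equals the Krull dimension of O_v. -/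
open scoped TensorProduct

open scoped nonZeroDivisors

/-- A nilpotent left ideal of a prime ring is zero. -/
theorem Ideal.eq_bot_of_isNilpotent_of_prime {E : Type*} [Ring E]
    (hE : ∀ x y : E, (∀ r : E, x * r * y = 0) → x = 0 ∨ y = 0)
    (J : Ideal E) (hJ : IsNilpotent J) : J = ⊥ := by
  obtain ⟨n, hn⟩ := hJ
  induction n with
  | zero =>
    have h1 : (1 : E) = 0 := by
      have : (1 : E) ∈ (J ^ 0 : Ideal E) := by rw [Submodule.pow_zero, Ideal.one_eq_top]; trivial
      rw [hn] at this
      simpa using this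
    rw [eq_bot_iff]
    intro x _
    rw [Submodule.mem_bot, ← mul_one x, h1, mul_zero]
  | succ n ih =>
    by_contra hJ0
    obtain ⟨x, hx, hx0⟩ := Submodule.exists_mem_ne_zero_of_ne_bot hJ0
    refine hJ0 (ih (eq_bot_iff.mpr fun y hy => ?_))
    refine (hE y x fun r => ?_).resolve_right hx0
    have : y * (r * x) ∈ J ^ n * J := Ideal.mul_mem_mul hy (J.mul_mem_left r hx)
    rw [← Submodule.mem_bot (R := E), mul_assoc]
    rw [← Submodule.pow_succ, hn] at this
    exact this

/-- A prime Artinian ring has no proper nonzero two-sided ideals. -/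
theorem Ideal.eq_top_of_isArtinianRing_of_prime {E : Type*} [Ring E] [IsArtinianRing E]
    (hE : ∀ x y : E, (∀ r : E, x * r * y = 0) → x = 0 ∨ y = 0)
    (I : Ideal E) (hI : ∀ a ∈ I, ∀ r : E, a * r ∈ I) (hI0 : I ≠ ⊥) : I = ⊤ := by
  have hss : IsSemisimpleRing E := by
    rw [IsArtinianRing.isSemisimpleRing_iff_jacobson]
    refine Ideal.eq_bot_of_isNilpotent_of_prime hE _ ?_
    have := IsArtinianRing.isNilpotent_jacobson_bot (R := E)
    rwa [← Ideal.jacobson_bot]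
  obtain ⟨K, hK⟩ := exists_isCompl I
  obtain ⟨x, hx, hx0⟩ := Submodule.exists_mem_ne_zero_of_ne_bot hI0
  have hK0 : K = ⊥ := by
    refine eq_bot_iff.mpr fun y hy => ?_
    refine (hE x y fun r => ?_).resolve_left hx0
    have : x * r * y ∈ I ⊓ K := ⟨hI _ (hI x hx r) y, K.mul_mem_left _ hy⟩
    rw [hK.inf_eq_bot] at this
    exact this
  simpa [hK0] using hK.sup_eq_top

/-- The generic fibre of an algebra of finite rank over a domain is an Artinian ring. -/
theorem isArtinianRing_localizedModule {A D : Type*} (K : Type*) [CommRing A] [IsDomain A]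
    [Field K] [Algebra A K] [IsFractionRing A K] [Ring D] [Algebra A D]
    (hrank : Module.rank A D < Cardinal.aleph0) : IsArtinianRing (LocalizedModule A⁰ D) := by
  let : Module K (LocalizedModule A⁰ D) := LocalizedModule.moduleOfIsLocalization
  have hfin : Module.Finite K (LocalizedModule A⁰ D) := by
    have h := IsLocalizedModule.lift_rank_eq A⁰ (LocalizedModule.mkLinearMap A⁰ D) (le_refl _)
    have h' := IsLocalization.rank_eq K A⁰ (le_refl _) (N := LocalizedModule A⁰ D)
    rw [← Module.rank_lt_aleph0_iff, h', ← Cardinal.lift_lt_aleph0, h, Cardinal.lift_lt_aleph0]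
    exact hrank
  have htower : IsScalarTower K (LocalizedModule A⁰ D) (LocalizedModule A⁰ D) :=
    ⟨LocalizedModule.smul'_mul⟩
  exact isArtinian_of_tower K inferInstance

/-- A nonzero two-sided ideal of a torsion-free prime algebra of finite rank over a domain
meets the domain nontrivially. -/
theorem Ideal.exists_algebraMap_mem_of_prime {A D : Type*} [CommRing A] [IsDomain A] [Ring D]
    [Algebra A D] (htf : ∀ (a : A) (d : D), a • d = 0 → a = 0 ∨ d = 0)
    (hrank : Module.rank A D < Cardinal.aleph0)
    (hD : ∀ x y : D, (∀ r : D, x * r * y = 0) → x = 0 ∨ y = 0)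
    (I : Ideal D) (hI : ∀ a ∈ I, ∀ r : D, a * r ∈ I) (hI0 : I ≠ ⊥) :
    ∃ a : A, a ≠ 0 ∧ algebraMap A D a ∈ I := by
  have hmk : ∀ (d : D) (s : A⁰), LocalizedModule.mk d s = 0 → d = 0 := by
    intro d s h
    rw [← LocalizedModule.zero_mk 1, LocalizedModule.mk_eq] at h
    obtain ⟨u, hu⟩ := h
    simp only [one_smul, smul_zero] at hu
    exact (htf u d hu).resolve_left (nonZeroDivisors.ne_zero u.2)
  have hart : IsArtinianRing (LocalizedModule A⁰ D) :=
    isArtinianRing_localizedModule (FractionRing A) hrank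
  have hE : ∀ x y : LocalizedModule A⁰ D, (∀ r, x * r * y = 0) → x = 0 ∨ y = 0 := by
    intro x y
    induction x, y using LocalizedModule.induction_on₂ with
    | h a b s t =>
      intro h
      have hab : ∀ r : D, a * r * b = 0 := fun r => by
        have := h (LocalizedModule.mk r 1)
        rw [LocalizedModule.mk_mul_mk, LocalizedModule.mk_mul_mk] at this
        exact hmk _ _ this
      exact (hD a b hab).imp (by rintro rfl; exact LocalizedModule.zero_mk s)
        (by rintro rfl; exact LocalizedModule.zero_mk t)
  let I' : Ideal (LocalizedModule A⁰ D) :=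
    { carrier := {z | ∃ x ∈ I, ∃ s, z = LocalizedModule.mk x s}
      add_mem' := by
        rintro _ _ ⟨x, hx, s, rfl⟩ ⟨y, hy, t, rfl⟩
        refine ⟨_, ?_, _, LocalizedModule.mk_add_mk⟩
        have hs : ∀ (c : A⁰) (z : D), z ∈ I → c • z ∈ I := fun c z hz => by
          rw [Submonoid.smul_def, Algebra.smul_def]; exact I.mul_mem_left _ hz
        exact I.add_mem (hs _ _ hx) (hs _ _ hy)
      zero_mem' := ⟨0, I.zero_mem, 1, (LocalizedModule.zero_mk 1).symm⟩
      smul_mem' := by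
        rintro c _ ⟨x, hx, s, rfl⟩
        induction c using LocalizedModule.induction_on with
        | h d t => exact ⟨_, I.mul_mem_left d hx, _, LocalizedModule.mk_mul_mk⟩ }
  have htop : I' = ⊤ := by
    refine Ideal.eq_top_of_isArtinianRing_of_prime hE I' ?_ ?_
    · rintro _ ⟨x, hx, s, rfl⟩ c
      induction c using LocalizedModule.induction_on with
      | h d t => exact ⟨_, hI x hx d, _, LocalizedModule.mk_mul_mk⟩
    · intro h
      obtain ⟨x, hx, hx0⟩ := Submodule.exists_mem_ne_zero_of_ne_bot hI0
      have : LocalizedModule.mk x 1 ∈ I' := ⟨x, hx, 1, rfl⟩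
      rw [h] at this
      exact hx0 (hmk x 1 this)
  have h1 : (1 : LocalizedModule A⁰ D) ∈ I' := htop ▸ trivial
  obtain ⟨x, hx, s, h⟩ := h1
  rw [show (1 : LocalizedModule A⁰ D) = LocalizedModule.mk 1 1 from OreLocalization.one_def,
    LocalizedModule.mk_eq] at h
  obtain ⟨u, hu⟩ := h
  refine ⟨u * s, mul_ne_zero (nonZeroDivisors.ne_zero u.2) (nonZeroDivisors.ne_zero s.2), ?_⟩
  rw [Algebra.algebraMap_eq_smul_one, mul_smul]
  simp only [Submonoid.smul_def] at hu
  rw [hu]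
  rw [OneMemClass.coe_one, one_smul, Algebra.smul_def]
  exact I.mul_mem_left _ hx

/-- In a valuation ring, a nonempty finite family has a member dividing all the others. -/
theorem ValuationRing.exists_dvd_of_finite {O ι : Type*} [CommRing O] [IsDomain O]
    [ValuationRing O] [Finite ι] [Nonempty ι] (c : ι → O) : ∃ j, ∀ i, c j ∣ c i := by
  have hD : Directed (fun a b : O => b ∣ a) c := fun i j => by
    rcases ValuationRing.dvd_total (c i) (c j) with h | h
    · exact ⟨i, dvd_rfl, h⟩
    · exact ⟨j, h, dvd_rfl⟩
  have : IsTrans O (fun a b : O => b ∣ a) := ⟨fun _ _ _ h h' => h'.trans h⟩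
  exact hD.finite_le id

/-- Linear independence over the residue domain lifts to linear independence over a
valuation ring. -/
theorem linearIndependent_of_quotient_comap {O R ι : Type*} [CommRing O] [IsDomain O]
    [ValuationRing O] [Ring R] [Algebra O R] [NoZeroSMulDivisors O R] [Fintype ι]
    (Q : Ideal R) [Q.IsTwoSided] (hQ : Q ≠ ⊤) (v : ι → R)
    (hv : LinearIndependent (O ⧸ Q.comap (algebraMap O R)) (fun i => Ideal.Quotient.mk Q (v i))) :
    LinearIndependent O v := by
  rw [Fintype.linearIndependent_iff] at hv ⊢
  intro c hc i
  have : Nonempty ι := ⟨i⟩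
  obtain ⟨j, hj⟩ := ValuationRing.exists_dvd_of_finite c
  choose d hd using hj
  by_cases hcj : c j = 0
  · rw [hd i, hcj, zero_mul]
  have hsum : ∑ i, d i • v i = 0 := by
    have : c j • ∑ i, d i • v i = 0 := by
      rw [Finset.smul_sum, ← hc]
      exact Finset.sum_congr rfl fun i _ => by rw [smul_smul, ← hd i]
    exact (eq_zero_or_eq_zero_of_smul_eq_zero this).resolve_left hcj
  have hdj : d j = 1 := mul_left_cancel₀ hcj (by rw [← hd j, mul_one])
  have hj := hv (fun i => Ideal.Quotient.mk _ (d i)) (by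
    rw [← map_zero (Ideal.Quotient.mk Q), ← hsum, map_sum]
    refine Finset.sum_congr rfl fun i _ => ?_
    rw [Algebra.smul_def, Algebra.smul_def, map_mul]
    rfl) j
  rw [hdj, Ideal.Quotient.eq_zero_iff_mem, Ideal.mem_comap, map_one] at hj
  exact absurd ((Ideal.eq_top_iff_one Q).mpr hj) hQ

theorem rank_quotient_comap_lt_aleph0 {O R : Type*} [CommRing O] [IsDomain O]
    [ValuationRing O] [Ring R] [Algebra O R] [NoZeroSMulDivisors O R]
    (hR : Module.rank O R < Cardinal.aleph0) (Q : Ideal R) [Q.IsTwoSided] (hQ : Q ≠ ⊤) :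
    Module.rank (O ⧸ Q.comap (algebraMap O R)) (R ⧸ Q) < Cardinal.aleph0 := by
  obtain ⟨n, hn⟩ := Cardinal.lt_aleph0.mp hR
  refine lt_of_le_of_lt (rank_le (n := n) fun s hs => ?_) (Cardinal.natCast_lt_aleph0)
  choose g hg using Ideal.Quotient.mk_surjective (I := Q)
  have hli : LinearIndependent O (fun i : s => g i) :=
    linearIndependent_of_quotient_comap Q hQ _ (by simpa only [hg] using hs)
  have := hli.cardinal_le_rank
  rw [hn] at this
  simpa using this

theorem rank_lt_aleph0_of_finite_tensorProduct (O F R : Type*) [CommRing O] [IsDomain O]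
    [Field F] [Algebra O F] [IsFractionRing O F] [AddCommGroup R] [Module O R]
    [Module.Finite F (F ⊗[O] R)] : Module.rank O R < Cardinal.aleph0 := by
  have h := (TensorProduct.isBaseChange O R F).lift_rank_eq
  rw [← Cardinal.lift_lt_aleph0, ← h, Cardinal.lift_lt_aleph0]
  exact Module.rank_lt_aleph0 _ _

theorem IsPrimeNC.isPrime_comap {O R : Type*} [CommRing O] [Ring R] [Algebra O R] {Q : Ideal R}
    (hQ : IsPrimeNC Q) : (Q.comap (algebraMap O R)).IsPrime := by
  refine ⟨fun h => hQ.1 ?_, fun {a b} hab => hQ.2 _ _ fun r => ?_⟩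
  · rw [Ideal.eq_top_iff_one] at h ⊢
    simpa using h
  · rw [Ideal.mem_comap, map_mul] at hab
    rw [Algebra.commutes, mul_assoc]
    exact Q.mul_mem_left r hab

/-- Incomparability of primes with the same contraction. -/
theorem IsPrimeNC.eq_of_le_of_comap_eq {O R : Type*} [CommRing O] [IsDomain O]
    [ValuationRing O] [Ring R] [Algebra O R] [NoZeroSMulDivisors O R]
    (hR : Module.rank O R < Cardinal.aleph0) {Q Q' : Ideal R} (hQ2 : IsTwoSidedI Q)
    (hQ : IsPrimeNC Q) (hQ2' : IsTwoSidedI Q') (hle : Q ≤ Q')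
    (hcomap : Q.comap (algebraMap O R) = Q'.comap (algebraMap O R)) : Q = Q' := by
  have : Q.IsTwoSided := ⟨fun {a} b ha => hQ2 a ha b⟩
  have := hQ.isPrime_comap (O := O)
  have hsurj := Ideal.Quotient.mk_surjective (I := Q)
  have hmem : ∀ x, Ideal.Quotient.mk Q x ∈ Q'.map (Ideal.Quotient.mk Q) → x ∈ Q' := fun x hx => by
    obtain ⟨y, hy, hxy⟩ := (Ideal.mem_map_iff_of_surjective _ hsurj).mp hx
    have := hle (Ideal.Quotient.eq.mp hxy)
    exact (Submodule.sub_mem_iff_right _ hy).mp this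
  refine le_antisymm hle fun x hx => ?_
  by_contra hxQ
  have hA : ∃ a : O ⧸ Q.comap (algebraMap O R), a ≠ 0 ∧
      algebraMap _ (R ⧸ Q) a ∈ Q'.map (Ideal.Quotient.mk Q) := by
    refine Ideal.exists_algebraMap_mem_of_prime ?_
      (rank_quotient_comap_lt_aleph0 hR Q hQ.1) ?_ _ ?_ ?_
    · intro a d h
      obtain ⟨a, rfl⟩ := Ideal.Quotient.mk_surjective a
      obtain ⟨d, rfl⟩ := hsurj d
      have h' : algebraMap O R a * d ∈ Q := by
        rw [← Ideal.Quotient.eq_zero_iff_mem, ← h, Algebra.smul_def, map_mul]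
        rfl
      rw [Ideal.Quotient.eq_zero_iff_mem, Ideal.Quotient.eq_zero_iff_mem]
      refine hQ.2 _ _ fun r => ?_
      rw [Algebra.commutes, mul_assoc]
      exact Q.mul_mem_left r h'
    · intro y z h
      obtain ⟨y, rfl⟩ := hsurj y
      obtain ⟨z, rfl⟩ := hsurj z
      rw [Ideal.Quotient.eq_zero_iff_mem, Ideal.Quotient.eq_zero_iff_mem]
      refine hQ.2 _ _ fun r => ?_
      rw [← Ideal.Quotient.eq_zero_iff_mem, map_mul, map_mul]
      exact h _
    · intro y hy r
      obtain ⟨y, rfl⟩ := hsurj y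
      obtain ⟨r, rfl⟩ := hsurj r
      rw [← map_mul]
      exact Ideal.mem_map_of_mem _ (hQ2' y (hmem y hy) r)
    · intro h
      have := Ideal.mem_map_of_mem (Ideal.Quotient.mk Q) hx
      rw [h, Submodule.mem_bot, Ideal.Quotient.eq_zero_iff_mem] at this
      exact hxQ this
  obtain ⟨a, ha, haQ⟩ := hA
  obtain ⟨a, rfl⟩ := Ideal.Quotient.mk_surjective a
  refine ha (Ideal.Quotient.eq_zero_iff_mem.mpr ?_)
  rw [hcomap]
  exact hmem _ haQ

/-- A two-sided ideal disjoint from an m-system is contained in a prime disjoint from it. -/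
theorem exists_isPrimeNC_of_disjoint {R : Type*} [Ring R] (I : Ideal R) (hI : IsTwoSidedI I)
    (T : Set R) (hT1 : 1 ∈ T) (hT : ∀ a ∈ T, ∀ b ∈ T, ∃ r, a * r * b ∈ T)
    (hdisj : ∀ a ∈ I, a ∉ T) :
    ∃ Q : Ideal R, IsTwoSidedI Q ∧ IsPrimeNC Q ∧ I ≤ Q ∧ ∀ a ∈ Q, a ∉ T := by
  obtain ⟨Q, hIQ, hQ⟩ := zorn_le_nonempty₀ {J : Ideal R | IsTwoSidedI J ∧ ∀ a ∈ J, a ∉ T}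
    (fun c hc hchain J hJ => by
      have hmem : ∀ a, a ∈ sSup c ↔ ∃ K ∈ c, a ∈ K := fun a =>
        Submodule.mem_sSup_of_directed ⟨J, hJ⟩ hchain.directedOn
      refine ⟨sSup c, ⟨fun a ha r => ?_, fun a ha => ?_⟩, fun K hK => le_sSup hK⟩
      · obtain ⟨K, hK, haK⟩ := (hmem a).mp ha
        exact (hmem _).mpr ⟨K, hK, (hc hK).1 a haK r⟩
      · obtain ⟨K, hK, haK⟩ := (hmem a).mp ha
        exact (hc hK).2 a haK) I ⟨hI, hdisj⟩
  obtain ⟨hQ2, hQT⟩ := hQ.prop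
  have hmeet : ∀ J : Ideal R, IsTwoSidedI J → Q ≤ J → ∀ x ∈ J, x ∉ Q → ∃ t ∈ J, t ∈ T := by
    intro J hJ hle x hx hxQ
    by_contra! h
    exact hxQ (hQ.le_of_ge ⟨hJ, h⟩ hle hx)
  refine ⟨Q, hQ2, ⟨fun h => hQT 1 (h ▸ trivial) hT1, fun x y hxy => ?_⟩, hIQ, hQT⟩
  by_contra! hxyQ
  let J : Ideal R :=
    { carrier := {z | ∀ r, x * r * z ∈ Q}
      add_mem' := fun {a b} ha hb r => by rw [mul_add]; exact Q.add_mem (ha r) (hb r)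
      zero_mem' := fun r => by rw [mul_zero]; exact Q.zero_mem
      smul_mem' := fun c z hz r => by
        rw [smul_eq_mul, ← mul_assoc, mul_assoc x]; exact hz (r * c) }
  obtain ⟨t, htJ, htT⟩ := hmeet J (fun a ha s r => by rw [← mul_assoc]; exact hQ2 _ (ha r) s)
    (fun z hz r => Q.mul_mem_left _ hz) y hxy hxyQ.2
  let K : Ideal R :=
    { carrier := {z | ∀ r, z * r * t ∈ Q}
      add_mem' := fun {a b} ha hb r => by rw [add_mul, add_mul]; exact Q.add_mem (ha r) (hb r)
      zero_mem' := fun r => by rw [zero_mul, zero_mul]; exact Q.zero_mem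
      smul_mem' := fun c z hz r => by
        rw [smul_eq_mul, mul_assoc, mul_assoc, ← mul_assoc z]; exact Q.mul_mem_left c (hz r) }
  obtain ⟨u, huK, huT⟩ := hmeet K (fun a ha s r => by rw [mul_assoc a]; exact ha (s * r))
    (fun z hz r => hQ2 _ (hQ2 z hz r) t) x htJ hxyQ.1
  obtain ⟨r, hr⟩ := hT u huT t htT
  exact hQT _ (huK r) hr

/-- Over a valuation ring, every element of the extension `pR` has the form `a • r`, `a ∈ p`. -/
def ValuationRing.extendIdeal {O : Type*} (R : Type*) [CommRing O] [IsDomain O] [ValuationRing O]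
    [Ring R] [Algebra O R] (p : Ideal O) : Ideal R where
  carrier := {x | ∃ a ∈ p, ∃ r : R, x = a • r}
  add_mem' := by
    rintro _ _ ⟨a, ha, r, rfl⟩ ⟨b, hb, s, rfl⟩
    rcases ValuationRing.dvd_total a b with ⟨c, rfl⟩ | ⟨c, rfl⟩
    · exact ⟨a, ha, r + c • s, by rw [smul_add, mul_smul]⟩
    · exact ⟨b, hb, c • r + s, by rw [smul_add, mul_smul]⟩
  zero_mem' := ⟨0, p.zero_mem, 0, by simp⟩
  smul_mem' := by
    rintro c _ ⟨a, ha, r, rfl⟩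
    exact ⟨a, ha, c * r, by simp⟩

theorem ValuationRing.isTwoSidedI_extendIdeal {O R : Type*} [CommRing O] [IsDomain O]
    [ValuationRing O] [Ring R] [Algebra O R] (p : Ideal O) : IsTwoSidedI (extendIdeal R p) := by
  rintro _ ⟨a, ha, r, rfl⟩ s
  exact ⟨a, ha, r * s, by simp⟩

theorem ValuationRing.algebraMap_mem_extendIdeal {O R : Type*} [CommRing O] [IsDomain O]
    [ValuationRing O] [Ring R] [Algebra O R] {p : Ideal O} {a : O} (ha : a ∈ p) :
    algebraMap O R a ∈ extendIdeal R p :=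
  ⟨a, ha, 1, Algebra.algebraMap_eq_smul_one a⟩

/-- Lying over for the maximal ideal. -/
theorem exists_isPrimeNC_comap_eq_maximalIdeal {O R : Type*} [CommRing O] [IsDomain O]
    [ValuationRing O] [Ring R] [Algebra O R]
    (hunit : ∀ a : O, IsUnit (algebraMap O R a) → IsUnit a) :
    ∃ Q : Ideal R, IsTwoSidedI Q ∧ IsPrimeNC Q ∧
      Q.comap (algebraMap O R) = IsLocalRing.maximalIdeal O := by
  obtain ⟨Q, hQ2, hQ, hle, -⟩ := exists_isPrimeNC_of_disjoint
    (ValuationRing.extendIdeal R (IsLocalRing.maximalIdeal O))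
    (ValuationRing.isTwoSidedI_extendIdeal _) {1} rfl
    (by rintro _ rfl _ rfl; exact ⟨1, by simp⟩) (by
      rintro _ ⟨a, ha, r, rfl⟩ h
      rw [Set.mem_singleton_iff, Algebra.smul_def] at h
      refine (IsLocalRing.mem_maximalIdeal a).mp ha (hunit a ?_)
      exact isUnit_iff_exists.mpr ⟨r, h, by rw [← Algebra.commutes, h]⟩)
  refine ⟨Q, hQ2, hQ, le_antisymm (IsLocalRing.le_maximalIdeal hQ.isPrime_comap.ne_top) ?_⟩
  exact fun a ha => hle (ValuationRing.algebraMap_mem_extendIdeal ha)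

/-- Going down. -/
theorem IsPrimeNC.exists_le_comap_eq {O R : Type*} [CommRing O] [IsDomain O]
    [ValuationRing O] [Ring R] [Algebra O R] [NoZeroSMulDivisors O R] {Q : Ideal R}
    (hQ : IsPrimeNC Q) (p : Ideal O) [p.IsPrime]
    (hp : p ≤ Q.comap (algebraMap O R)) :
    ∃ P : Ideal R, IsTwoSidedI P ∧ IsPrimeNC P ∧ P ≤ Q ∧ P.comap (algebraMap O R) = p := by
  have h1 : (1 : O) ∉ p := (Ideal.ne_top_iff_one p).mp (Ideal.IsPrime.ne_top ‹_›)
  have h1Q : (1 : R) ∉ Q := (Ideal.ne_top_iff_one Q).mp hQ.1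
  obtain ⟨P, hP2, hP, hle, hPT⟩ := exists_isPrimeNC_of_disjoint
    (ValuationRing.extendIdeal R p) (ValuationRing.isTwoSidedI_extendIdeal _)
    {z | ∃ s ∉ p, ∃ a ∉ Q, z = s • a} ⟨1, h1, 1, h1Q, (one_smul _ _).symm⟩ (by
      rintro _ ⟨s, hs, a, ha, rfl⟩ _ ⟨t, ht, b, hb, rfl⟩
      obtain ⟨r, hr⟩ : ∃ r, a * r * b ∉ Q := by
        by_contra! h
        exact (hQ.2 a b h).elim ha hb
      refine ⟨r, s * t, fun h => (Ideal.IsPrime.mem_or_mem ‹_› h).elim hs ht, _, hr, ?_⟩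
      rw [smul_mul_assoc, smul_mul_assoc, mul_smul_comm, mul_smul]) (by
      rintro _ ⟨c, hc, r, rfl⟩ ⟨s, hs, a, ha, h⟩
      rcases ValuationRing.dvd_total s c with ⟨d, rfl⟩ | hcs
      · have hd : d ∈ p := (Ideal.IsPrime.mem_or_mem ‹_› hc).resolve_left hs
        have hs0 : s ≠ 0 := by rintro rfl; exact hs p.zero_mem
        have h0 : s • (d • r - a) = 0 := by rw [smul_sub, ← mul_smul, h, sub_self]
        have hda := sub_eq_zero.mp ((eq_zero_or_eq_zero_of_smul_eq_zero h0).resolve_left hs0)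
        refine ha ?_
        rw [← hda, Algebra.smul_def, Algebra.commutes]
        exact Q.mul_mem_left r (hp hd)
      · exact hs (p.mem_of_dvd hcs hc))
  refine ⟨P, hP2, hP, fun a ha => ?_, le_antisymm (fun a ha => ?_) fun a ha =>
    hle (ValuationRing.algebraMap_mem_extendIdeal ha)⟩
  · by_contra haQ
    exact hPT a ha ⟨1, h1, a, haQ, (one_smul _ _).symm⟩
  · by_contra hap
    exact hPT _ ha ⟨a, hap, 1, h1Q, Algebra.algebraMap_eq_smul_one a⟩

theorem height_comap_le_of_isPrimeNC {O R : Type*} [CommRing O] [IsDomain O]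
    [ValuationRing O] [Ring R] [Algebra O R] [NoZeroSMulDivisors O R]
    (p : LTSeries (PrimeSpectrum O)) (Q : {Q : Ideal R // IsTwoSidedI Q ∧ IsPrimeNC Q})
    (h : Q.1.comap (algebraMap O R) = p.last.asIdeal) : (p.length : ℕ∞) ≤ Order.height Q := by
  induction hn : p.length generalizing p Q with
  | zero => simp
  | succ n ih =>
    have hlt : p.eraseLast.last < p.last := p.eraseLast_last_rel_last (by omega)
    obtain ⟨P, hP2, hP, hPQ, hPp⟩ := Q.2.2.exists_le_comap_eq p.eraseLast.last.asIdeal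
      (h ▸ hlt.le)
    have hPQ' : (⟨P, hP2, hP⟩ : {Q : Ideal R // IsTwoSidedI Q ∧ IsPrimeNC Q}) < Q := by
      refine lt_of_le_of_ne hPQ ?_
      rintro rfl
      exact hlt.ne (PrimeSpectrum.ext (hPp.symm.trans h))
    have := ih p.eraseLast ⟨P, hP2, hP⟩ hPp (by simp [hn])
    push_cast
    exact (add_le_add_left this 1).trans (Order.height_add_one_le hPQ')

/-- Let `O` be a valuation domain with fraction field `F` and `R` a
torsion-free `O`-algebra with `R ⊗[O] F` finite dimensional over `F` and
`(R^× ∩ O) ⊆ O^×`.  Then the Krull dimension of `R` (the supremum of lengths of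
chains of prime two-sided ideals) equals the Krull dimension of `O`. -/
theorem stmt8 {O F R : Type*} [CommRing O] [IsDomain O] [ValuationRing O]
    [Field F] [Algebra O F] [IsFractionRing O F]
    [Ring R] [Algebra O R] [NoZeroSMulDivisors O R]
    [Module.Finite F (F ⊗[O] R)]
    (hunit : ∀ a : O, IsUnit (algebraMap O R a) → IsUnit a) :
    Order.krullDim {Q : Ideal R // IsTwoSidedI Q ∧ IsPrimeNC Q} = ringKrullDim O := by
  refine le_antisymm ?_ ?_
  · let f : {Q : Ideal R // IsTwoSidedI Q ∧ IsPrimeNC Q} → PrimeSpectrum O :=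
      fun Q => ⟨Q.1.comap (algebraMap O R), Q.2.2.isPrime_comap⟩
    refine Order.krullDim_le_of_strictMono f fun Q Q' hlt => lt_of_le_of_ne ?_ fun h => hlt.ne ?_
    · exact Ideal.comap_mono hlt.le
    · exact Subtype.ext (Q.2.2.eq_of_le_of_comap_eq
        (rank_lt_aleph0_of_finite_tensorProduct O F R) Q.2.1 Q'.2.1 hlt.le
        (congrArg PrimeSpectrum.asIdeal h))
  · obtain ⟨M, hM2, hM, hMO⟩ := exists_isPrimeNC_comap_eq_maximalIdeal hunit
    refine iSup_le fun p => ?_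
    obtain ⟨Q, hQ2, hQ, -, hQp⟩ := hM.exists_le_comap_eq p.last.asIdeal
      (hMO ▸ IsLocalRing.le_maximalIdeal p.last.isPrime.ne_top)
    have h := height_comap_le_of_isPrimeNC p ⟨Q, hQ2, hQ⟩ hQp
    exact (WithBot.coe_le_coe.mpr h).trans (Order.height_le_krullDim _)
end
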